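/- For all i, j ∈ {1,…,N}: (a) there exists exactly one U ∈ U_sym such that U|x⟩ = T_{x_j⁻¹}|x⟩ for every x ∈ G^N with x_i = e; (b) this U maps every vector of the form |e⟩_i ⊗ φ (φ ∈ ℂ^{G^{N−1}}) to a vector of the form |e⟩_j ⊗ φ̃, and the induced map V_{i→j} : φ ↦ φ̃ is a well-defined unitary on ℂ^{G^{N−1}}; (c) if i ≠ j and |G| ≥ 2, then U is not a global translation, i.e. U ≠ T_g for every g ∈ G; (d) consequently, every i-alignable vector ψ ∈ H_N is also j-alignable. -/

import Mathlib

noncomputable section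

open Matrix

namespace QRF

section Defs

variable (G : Type) [Fintype G] [DecidableEq G] [CommGroup G]

/-- The `K`-particle Hilbert space `ℂ^{G^K}` (as functions `G^K → ℂ`). -/
abbrev Vec (K : ℕ) : Type := (Fin K → G) → ℂ

/-- Linear operators on the `K`-particle Hilbert space. -/
abbrev Op (K : ℕ) : Type := Matrix (Fin K → G) (Fin K → G) ℂ

variable {G}

/-- The standard basis vector `|x⟩`. -/
def ket {K : ℕ} (x : Fin K → G) : Vec G K := fun y => if y = x then 1 else 0

/-- The global translation `T_g`, `T_g |x₁,…,x_K⟩ = |g x₁, …, g x_K⟩`. -/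
def trans {K : ℕ} (g : G) : Op G K :=
  Matrix.of fun x y => if x = (fun i => g * y i) then 1 else 0

/-- The configuration `(g, h₁ g, …, h_k g)`, i.e. `|g, hg⟩`. -/
def cfg {k : ℕ} (h : Fin k → G) (g : G) : Fin (k + 1) → G :=
  Fin.cons g fun i => h i * g

/-- The inner product `⟨v, w⟩` (antilinear in the first argument). -/
def inn {K : ℕ} (v w : Vec G K) : ℂ := star v ⬝ᵥ w

/-- The rank-one operator `|v⟩⟨w|`. -/
def outer {K : ℕ} (v w : Vec G K) : Op G K :=
  Matrix.of fun x y => v x * (starRingEnd ℂ) (w y)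

/-- The matrix element `⟨v|A|w⟩`. -/
def melem {K : ℕ} (v : Vec G K) (A : Op G K) (w : Vec G K) : ℂ :=
  star v ⬝ᵥ A.mulVec w

/-- The Hilbert–Schmidt inner product `⟨A,B⟩ := tr(A† B)`. -/
def hsInner {K : ℕ} (A B : Op G K) : ℂ := (Aᴴ * B).trace

variable (G)

/-- The symmetry group `U_sym` of relation-conditional global translations
(for `k+1` particles). -/
def Usym (k : ℕ) : Set (Op G (k + 1)) :=
  {U | U ∈ Matrix.unitaryGroup (Fin (k + 1) → G) ℂ ∧
    ∃ c : (Fin k → G) → G, ∀ (h : Fin k → G) (g : G),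
      U.mulVec (ket (cfg h g)) = (trans (c h)).mulVec (ket (cfg h g))}

/-- The characters of `G`: monoid homomorphisms `G → ℂ` of modulus one. -/
def Ghat : Type := {χ : G →* ℂ // ∀ g : G, ‖χ g‖ = 1}

/-- The trivial character `𝟙`. -/
instance : One (Ghat G) := ⟨⟨1, fun g => by simp⟩⟩

variable {G}

/-- The vector `|h;χ⟩ := |G|^{-1/2} ∑_{g ∈ G} χ(g⁻¹) |g, hg⟩`. -/
def relKet {k : ℕ} (h : Fin k → G) (χ : Ghat G) : Vec G (k + 1) :=
  ((Real.sqrt (Fintype.card G) : ℂ))⁻¹ • ∑ g : G, χ.1 g⁻¹ • ket (cfg h g)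

variable (G)

/-- The relational subspace `H_phys = span{|h;𝟙⟩}`. -/
def Hphys (k : ℕ) : Submodule ℂ (Vec G (k + 1)) :=
  Submodule.span ℂ {v | ∃ h : Fin k → G, v = relKet h (1 : Ghat G)}

/-- `Π_phys = ∑_h |h;𝟙⟩⟨h;𝟙|`, the orthogonal projection onto `H_phys`. -/
def Piphys (k : ℕ) : Op G (k + 1) :=
  ∑ h : Fin k → G, outer (relKet h (1 : Ghat G)) (relKet h (1 : Ghat G))

variable {G}

/-- `Π_{h;χ≠𝟙} = ∑_{χ ∈ Ĝ, χ ≠ 𝟙} |h;χ⟩⟨h;χ|`. -/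
def PiNot1 {k : ℕ} (h : Fin k → G) : Op G (k + 1) :=
  ∑ᶠ (χ : Ghat G) (_ : χ ≠ 1), outer (relKet h χ) (relKet h χ)

variable (G)

/-- The invariant algebra `A_inv`. -/
def Ainv (k : ℕ) : Set (Op G (k + 1)) :=
  {A | ∀ U ∈ Usym G k, U * A * Uᴴ = A}

/-- The incoherent group average (twirl) `Π_inv` over `U_sym`. -/
def Piinv (k : ℕ) (ρ : Op G (k + 1)) : Op G (k + 1) :=
  (Nat.card ↥(Usym G k) : ℂ)⁻¹ • ∑ᶠ U ∈ Usym G k, U * ρ * Uᴴ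

/-- The algebra `A_phys` of relational observables (operators supported on `H_phys`). -/
def Aphys (k : ℕ) : Set (Op G (k + 1)) :=
  {A | A = Piphys G k * A * Piphys G k}

/-- The algebra `A_alg`. -/
def Aalg (k : ℕ) : Set (Op G (k + 1)) :=
  {X | ∃ B ∈ Aphys G k, ∃ a : (Fin k → G) → ℂ,
      X = B + ∑ h : Fin k → G, a h • PiNot1 h}

variable {G}

/-- The vector `|e⟩_i ⊗ φ`. -/
def insVec {k : ℕ} (i : Fin (k + 1)) (φ : (Fin k → G) → ℂ) : Vec G (k + 1) :=
  fun x => if x i = 1 then φ (fun j => x (i.succAbove j)) else 0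

/-- The operator `|e⟩⟨e|_i ⊗ A`. -/
def eAop {k : ℕ} (i : Fin (k + 1)) (A : Matrix (Fin k → G) (Fin k → G) ℂ) :
    Op G (k + 1) :=
  Matrix.of fun x y =>
    if x i = 1 ∧ y i = 1 then
      A (fun j => x (i.succAbove j)) (fun j => y (i.succAbove j))
    else 0

/-- `ψ` is `i`-alignable. -/
def IAlignable {k : ℕ} (i : Fin (k + 1)) (ψ : Vec G (k + 1)) : Prop :=
  ∃ (θ : ℝ) (U : Op G (k + 1)) (φ : (Fin k → G) → ℂ),
    U ∈ Usym G k ∧ ψ = Complex.exp (θ * Complex.I) • U.mulVec (insVec i φ)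

/-- `ψ` is alignable. -/
def Alignable {k : ℕ} (ψ : Vec G (k + 1)) : Prop := ∃ i, IAlignable i ψ

/-- Symmetry equivalence of state vectors (up to a global phase). -/
def SymmEquiv {k : ℕ} (ψ ψ' : Vec G (k + 1)) : Prop :=
  ∃ (θ : ℝ) (U : Op G (k + 1)),
    U ∈ Usym G k ∧ ψ' = Complex.exp (θ * Complex.I) • U.mulVec ψ

/-- `P` is the orthogonal projection of operator space onto the set `S`,
with respect to the Hilbert–Schmidt inner product. -/
def IsHSProj {K : ℕ} (S : Set (Op G K)) (P : Op G K →ₗ[ℂ] Op G K) : Prop :=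
  (∀ ρ, P ρ ∈ S) ∧ (∀ A ∈ S, P A = A) ∧
    ∀ ρ σ, hsInner (P ρ) σ = hsInner ρ (P σ)

/-- First `n+1` components of an `(n+1)+(m+1)`-particle configuration. -/
def split1 {n m : ℕ} (x : Fin (n + m + 1 + 1) → G) : Fin (n + 1) → G :=
  fun i => x ⟨i.1, by have := i.2; omega⟩

/-- Last `m+1` components of an `(n+1)+(m+1)`-particle configuration. -/
def split2 {n m : ℕ} (x : Fin (n + m + 1 + 1) → G) : Fin (m + 1) → G :=
  fun i => x ⟨n + 1 + i.1, by have := i.2; omega⟩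

/-- The tensor product `A ⊗ B` of operators, under the identification
`H_{N+M} ≅ H_N ⊗ H_M`, `|x,y⟩ ↦ |x⟩ ⊗ |y⟩`. -/
def tensorOp {n m : ℕ} (A : Op G (n + 1)) (B : Op G (m + 1)) :
    Op G (n + m + 1 + 1) :=
  Matrix.of fun x y => A (split1 x) (split1 y) * B (split2 x) (split2 y)

/-- Concatenation `(h, g⃗)` of relation tuples. -/
def relcat {n m : ℕ} (h : Fin n → G) (gv : Fin (m + 1) → G) :
    Fin (n + m + 1) → G :=
  (Fin.append h gv : Fin (n + (m + 1)) → G)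

/-- Joining of configurations `(x, z)`. -/
def join {n m : ℕ} (x : Fin (n + 1) → G) (z : Fin (m + 1) → G) :
    Fin (n + m + 1 + 1) → G :=
  fun i => if hi : i.1 < n + 1 then x ⟨i.1, hi⟩
           else z ⟨i.1 - (n + 1), by have := i.2; omega⟩

/-- The standard partial trace over the last `m+1` particles. -/
def ptraceM {n m : ℕ} (ρ : Op G (n + m + 1 + 1)) : Op G (n + 1) :=
  Matrix.of fun x y => ∑ z : Fin (m + 1) → G, ρ (join x z) (join y z)

end Defs

lemma permMatrix_mem_unitaryGroup {ι : Type*} [Fintype ι] [DecidableEq ι] (σ : Equiv.Perm ι) :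
    σ.permMatrix ℂ ∈ Matrix.unitaryGroup ι ℂ := by
  rw [Matrix.mem_unitaryGroup_iff, star_eq_conjTranspose, conjTranspose_permMatrix,
    ← permMatrix_mul, inv_mul_cancel, permMatrix_one]

section Configurations

variable {G : Type} [CommGroup G]

/-- The relations `h` of a configuration `x = (g, hg)`. -/
def rel {k : ℕ} (x : Fin (k + 1) → G) : Fin k → G := fun l => x l.succ * (x 0)⁻¹

lemma cfg_rel {k : ℕ} (x : Fin (k + 1) → G) (g : G) :
    cfg (rel x) g = fun l => g * (x 0)⁻¹ * x l := by
  ext l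
  cases l using Fin.cases with
  | zero => simp [cfg]
  | succ l => simp [cfg, rel, mul_comm, mul_left_comm]

lemma mul_cfg {k : ℕ} (h : Fin k → G) (a g : G) : (fun l => a * cfg h g l) = cfg h (a * g) := by
  ext l
  cases l using Fin.cases <;> simp [cfg, mul_left_comm]

lemma cfg_eq_mul_cfg_one {k : ℕ} (h : Fin k → G) (g : G) (l : Fin (k + 1)) :
    cfg h g l = g * cfg h 1 l := by
  simpa using (congrFun (mul_cfg h g 1) l).symm

/-- The permutation `x ↦ (x_i x_j⁻¹) x` of configurations, which preserves relations and sends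
configurations with `x_i = e` to configurations with `x_j = e`. -/
def frameChange {k : ℕ} (i j : Fin (k + 1)) : Equiv.Perm (Fin (k + 1) → G) where
  toFun x l := x i * (x j)⁻¹ * x l
  invFun x l := x j * (x i)⁻¹ * x l
  left_inv x := by
    ext l
    simp [_root_.mul_inv_rev, mul_assoc]
  right_inv x := by
    ext l
    simp [_root_.mul_inv_rev, mul_assoc]

/-- The configuration of the other particles relative to `i`, computed from the configuration `z`
of the other particles relative to `j`. -/
def reducedMap {k : ℕ} (i j : Fin (k + 1)) (z : Fin k → G) : Fin k → G := fun l =>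
  ((j.insertNth 1 z : Fin (k + 1) → G) i)⁻¹ * (j.insertNth 1 z : Fin (k + 1) → G) (i.succAbove l)

lemma insertNth_reducedMap {k : ℕ} (i j : Fin (k + 1)) (z : Fin k → G) :
    (i.insertNth 1 (reducedMap i j z) : Fin (k + 1) → G) =
      fun l =>
        ((j.insertNth 1 z : Fin (k + 1) → G) i)⁻¹ * (j.insertNth 1 z : Fin (k + 1) → G) l := by
  rw [Fin.insertNth_eq_iff]
  exact ⟨(inv_mul_cancel _).symm, rfl⟩

lemma reducedMap_reducedMap {k : ℕ} (i j : Fin (k + 1)) (z : Fin k → G) :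
    reducedMap j i (reducedMap i j z) = z := by
  ext l
  rw [reducedMap, insertNth_reducedMap]
  simp

/-- The frame change as a bijection between reduced configurations. -/
def reducedEquiv {k : ℕ} (i j : Fin (k + 1)) : Equiv.Perm (Fin k → G) where
  toFun := reducedMap i j
  invFun := reducedMap j i
  left_inv := reducedMap_reducedMap i j
  right_inv := reducedMap_reducedMap j i

end Configurations

section Kets

variable {G : Type} [DecidableEq G]

lemma ket_eq_single {K : ℕ} (x : Fin K → G) : ket x = Pi.single x 1 := by
  ext y
  simp [ket, Pi.single_apply]

lemma ket_injective {K : ℕ} : Function.Injective (ket : (Fin K → G) → Vec G K) := by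
  intro x y h
  by_contra hne
  simpa [ket, hne] using congrFun h x

lemma mulVec_ket [Fintype G] {K : ℕ} (A : Op G K) (x : Fin K → G) : A *ᵥ ket x = A.col x := by
  rw [ket_eq_single, mulVec_single_one]

end Kets

section Operators

variable {G : Type} [Fintype G] [DecidableEq G] [CommGroup G]

lemma trans_mulVec_ket {K : ℕ} (g : G) (x : Fin K → G) :
    trans g *ᵥ ket x = ket fun l => g * x l := by
  rw [mulVec_ket]
  rfl

/-- `U_sym` is closed under products. -/
lemma mul_mem_Usym {k : ℕ} {U W : Op G (k + 1)} (hU : U ∈ Usym G k) (hW : W ∈ Usym G k) :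
    U * W ∈ Usym G k := by
  obtain ⟨hU, c, hc⟩ := hU
  obtain ⟨hW, d, hd⟩ := hW
  refine ⟨mul_mem hU hW, fun h => c h * d h, fun h g => ?_⟩
  rw [← mulVec_mulVec, hd, trans_mulVec_ket, mul_cfg, hc, trans_mulVec_ket, trans_mulVec_ket,
    mul_cfg, mul_cfg, mul_assoc]

/-- The unitary `|x⟩ ↦ T_{x_i x_j⁻¹}|x⟩` in `U_sym` that changes frame from `i` to `j`. -/
def frameOp {k : ℕ} (i j : Fin (k + 1)) : Op G (k + 1) :=
  (frameChange j i).permMatrix ℂ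

lemma frameOp_mulVec {k : ℕ} (i j : Fin (k + 1)) (v : Vec G (k + 1)) :
    frameOp i j *ᵥ v = fun x => v fun l => x j * (x i)⁻¹ * x l :=
  permMatrix_mulVec _

lemma frameOp_mulVec_ket {k : ℕ} (i j : Fin (k + 1)) (x : Fin (k + 1) → G) :
    frameOp i j *ᵥ ket x = ket fun l => x i * (x j)⁻¹ * x l := by
  ext y
  rw [frameOp_mulVec]
  exact if_congr (frameChange i j).symm_apply_eq rfl rfl

lemma frameOp_mem_Usym {k : ℕ} (i j : Fin (k + 1)) : (frameOp i j : Op G (k + 1)) ∈ Usym G k := by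
  refine ⟨permMatrix_mem_unitaryGroup _, fun h => cfg h 1 i * (cfg h 1 j)⁻¹, fun h g => ?_⟩
  rw [frameOp_mulVec_ket, trans_mulVec_ket, cfg_eq_mul_cfg_one h g i, cfg_eq_mul_cfg_one h g j]
  congr! 3
  rw [mul_inv, mul_mul_mul_comm, mul_inv_cancel, one_mul]

lemma frameOp_mulVec_ket_of_eq_one {k : ℕ} (i j : Fin (k + 1)) (x : Fin (k + 1) → G)
    (hx : x i = 1) : frameOp i j *ᵥ ket x = trans (x j)⁻¹ *ᵥ ket x := by
  rw [frameOp_mulVec_ket, trans_mulVec_ket, hx, one_mul]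

/-- An element of `U_sym` is determined by its action on configurations with `x_i = e`. -/
lemma eq_of_mem_Usym {k : ℕ} {i : Fin (k + 1)} {U W : Op G (k + 1)} (hU : U ∈ Usym G k)
    (hW : W ∈ Usym G k) (h : ∀ x : Fin (k + 1) → G, x i = 1 → U *ᵥ ket x = W *ᵥ ket x) :
    U = W := by
  obtain ⟨-, c, hc⟩ := hU
  obtain ⟨-, d, hd⟩ := hW
  refine Matrix.ext_col fun x => ?_
  have hx : x = cfg (rel x) (x 0) := by simp [cfg_rel]
  have hcd : c (rel x) = d (rel x) := by
    have key := h (cfg (rel x) (x 0 * (x i)⁻¹)) (by simp [cfg_rel])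
    rw [hc, hd, trans_mulVec_ket, trans_mulVec_ket] at key
    exact mul_right_cancel (congrFun (ket_injective key) 0)
  rw [← mulVec_ket, ← mulVec_ket, hx, hc, hd, hcd]

lemma eq_frameOp {k : ℕ} {i j : Fin (k + 1)} {U : Op G (k + 1)} (hU : U ∈ Usym G k)
    (h : ∀ x : Fin (k + 1) → G, x i = 1 → U *ᵥ ket x = trans (x j)⁻¹ *ᵥ ket x) :
    U = frameOp i j :=
  eq_of_mem_Usym hU (frameOp_mem_Usym i j) fun x hx => by
    rw [h x hx, frameOp_mulVec_ket_of_eq_one i j x hx]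

lemma frameOp_mulVec_insVec {k : ℕ} (i j : Fin (k + 1)) (φ : (Fin k → G) → ℂ) :
    frameOp i j *ᵥ insVec i φ = insVec j ((reducedEquiv i j).permMatrix ℂ *ᵥ φ) := by
  rw [frameOp_mulVec, permMatrix_mulVec]
  ext x
  simp only [insVec, inv_mul_cancel_right]
  refine ite_congr rfl (fun hx => congrArg φ ?_) fun _ => rfl
  have hins : (j.insertNth 1 (fun l => x (j.succAbove l)) : Fin (k + 1) → G) = x :=
    Fin.insertNth_eq_iff.2 ⟨hx.symm, rfl⟩
  ext l
  simp [reducedEquiv, reducedMap, hins, hx]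

lemma frameOp_ne_trans {k : ℕ} {i j : Fin (k + 1)} (hij : i ≠ j) (hG : 2 ≤ Fintype.card G)
    (g : G) : frameOp i j ≠ trans g := by
  intro h
  have hk (x : Fin (k + 1) → G) : x i * (x j)⁻¹ = g := by
    have key := frameOp_mulVec_ket i j x
    rw [h, trans_mulVec_ket] at key
    exact (mul_right_cancel (congrFun (ket_injective key) 0)).symm
  have : Nontrivial G := Fintype.one_lt_card_iff_nontrivial.1 hG
  obtain ⟨a, ha⟩ := exists_ne (1 : G)
  have h₁ := hk 1
  have h₂ := hk (Pi.mulSingle i a)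
  rw [Pi.mulSingle_eq_same, Pi.mulSingle_eq_of_ne hij.symm] at h₂
  simp at h₁ h₂
  exact ha (h₂.trans h₁.symm)

end Operators

/-- (a) There is exactly one `U ∈ U_sym` with
`U|x⟩ = T_{x_j⁻¹}|x⟩` on all configurations `x` with `x_i = e`;
(b) it maps `|e⟩_i ⊗ φ` to `|e⟩_j ⊗ φ̃` with the induced map `V_{i→j} : φ ↦ φ̃`
a well-defined unitary; (c) if `i ≠ j` and `|G| ≥ 2` then `U` is not a global
translation; (d) hence every `i`-alignable vector is `j`-alignable. -/
theorem stmt8 (G : Type) [Fintype G] [DecidableEq G] [CommGroup G] (n : ℕ)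
    (i j : Fin (n + 1)) :
    (∃! U : Op G (n + 1), U ∈ Usym G n ∧
      ∀ x : Fin (n + 1) → G, x i = 1 →
        U.mulVec (ket x) = (trans ((x j)⁻¹)).mulVec (ket x)) ∧
    (∀ U : Op G (n + 1),
      (U ∈ Usym G n ∧ ∀ x : Fin (n + 1) → G, x i = 1 →
        U.mulVec (ket x) = (trans ((x j)⁻¹)).mulVec (ket x)) →
      (∃ V : Matrix (Fin n → G) (Fin n → G) ℂ,
        V ∈ Matrix.unitaryGroup (Fin n → G) ℂ ∧
        ∀ φ : (Fin n → G) → ℂ, U.mulVec (insVec i φ) = insVec j (V.mulVec φ)) ∧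
      (i ≠ j → 2 ≤ Fintype.card G → ∀ g : G, U ≠ trans g)) ∧
    (∀ ψ : Vec G (n + 1), IAlignable i ψ → IAlignable j ψ) := by
  refine ⟨⟨frameOp i j, ⟨frameOp_mem_Usym i j, frameOp_mulVec_ket_of_eq_one i j⟩,
    fun U hU => eq_frameOp hU.1 hU.2⟩, fun U hU => ?_, ?_⟩
  · rw [eq_frameOp hU.1 hU.2]
    exact ⟨⟨_, permMatrix_mem_unitaryGroup _, frameOp_mulVec_insVec i j⟩, frameOp_ne_trans⟩
  · rintro ψ ⟨θ, U, φ, hU, rfl⟩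
    have hV := Matrix.mem_unitaryGroup_iff.1
      (permMatrix_mem_unitaryGroup (reducedEquiv (G := G) j i))
    refine ⟨θ, U * frameOp j i, star ((reducedEquiv j i).permMatrix ℂ) *ᵥ φ,
      mul_mem_Usym hU (frameOp_mem_Usym j i), ?_⟩
    rw [← mulVec_mulVec, frameOp_mulVec_insVec, mulVec_mulVec, hV, one_mulVec]

end QRF

end
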